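/- If h = 0 and β > β_c, then f_{β,0} has exactly q global minimizers on Ω, and there exists z ∈ ((q−2)/q, 1) such that these minimizers are exactly the q vectors obtained from x_z by permuting the coordinates. -/

import Mathlib

open Real Filter Finset

/-- The simplex `Ω = {x ∈ ℝ^q : x_1 + ⋯ + x_q = 1, x_i ≥ 0}`. -/
def simplex (q : ℕ) : Set (Fin q → ℝ) := {x | (∀ i, 0 ≤ x i) ∧ ∑ i, x i = 1}

/-- The Curie–Weiss Potts free energy. -/
noncomputable def freeEnergy (q : ℕ) [NeZero q] (β h : ℝ) (x : Fin q → ℝ) : ℝ :=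
  ∑ i, x i * Real.log (x i) - β / 2 * ∑ i, x i ^ 2 - h * x 0

/-- The critical inverse temperature `β_c`. -/
noncomputable def betaC (q : ℕ) : ℝ :=
  if q ≤ 2 then (q : ℝ) else 2 * ((q : ℝ) - 1) / ((q : ℝ) - 2) * Real.log ((q : ℝ) - 1)

/-- The vector `x_z = ((1+z)/2, (1−z)/(2(q−1)), …, (1−z)/(2(q−1)))`. -/
noncomputable def xvec (q : ℕ) [NeZero q] (z : ℝ) : Fin q → ℝ :=
  fun i => if i = 0 then (1 + z) / 2 else (1 - z) / (2 * ((q : ℝ) - 1))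

/-- The contribution of a single coordinate to the free energy with `h = 0`. -/
noncomputable def siteEnergy (β t : ℝ) : ℝ := t * Real.log t - β / 2 * t ^ 2

/-- The vector with value `b` at `i` and value `(1 - b) / (q - 1)` at all other coordinates. -/
noncomputable def peakVec (q : ℕ) (b : ℝ) (i : Fin q) : Fin q → ℝ :=
  fun k => if k = i then b else (1 - b) / ((q : ℝ) - 1)

/-- The derivative of the free energy along the curve `b ↦ peakVec q b i`, with `n = q - 1`. -/
noncomputable def peakSlope (n β b : ℝ) : ℝ :=
  Real.log b - Real.log (1 - b) + Real.log n - β * ((n + 1) * b - 1) / n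

/-- The global minimizers of the free energy with `h = 0` on the simplex. -/
def minimizers (q : ℕ) [NeZero q] (β : ℝ) : Set (Fin q → ℝ) :=
  {y | y ∈ simplex q ∧ ∀ w ∈ simplex q, freeEnergy q β 0 y ≤ freeEnergy q β 0 w}

section SiteEnergy

variable {β : ℝ}

lemma continuous_siteEnergy : Continuous (siteEnergy β) :=
  Real.continuous_mul_log.sub (by fun_prop)

lemma log_sub_mul_strictAntiOn (hβ : 0 < β) :
    StrictAntiOn (fun t => Real.log t - β * t) (Set.Ici (1 / β)) := by
  intro x hx y _ hxy
  have hx1 : 1 / β ≤ x := hx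
  have hx0 : 0 < x := lt_of_lt_of_le (by positivity) hx1
  have h := Real.log_lt_sub_one_of_pos (div_pos (hx0.trans hxy) hx0)
    (by rw [Ne, div_eq_one_iff_eq hx0.ne']; exact hxy.ne')
  rw [Real.log_div (hx0.trans hxy).ne' hx0.ne'] at h
  have h2 : y / x - 1 ≤ β * (y - x) := by
    rw [div_sub_one hx0.ne', div_le_iff₀ hx0]
    rw [div_le_iff₀ hβ] at hx1
    nlinarith
  simp only
  linarith

lemma log_sub_mul_strictMonoOn (hβ : 0 < β) :
    StrictMonoOn (fun t => Real.log t - β * t) (Set.Ioc 0 (1 / β)) := by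
  intro x hx y hy hxy
  have hx0 : 0 < x := hx.1
  have hy0 : 0 < y := hy.1
  have hy1 : y * β ≤ 1 := (le_div_iff₀ hβ).1 hy.2
  have h := Real.log_lt_sub_one_of_pos (div_pos hx0 hy0)
    (by rw [Ne, div_eq_one_iff_eq hy0.ne']; exact hxy.ne)
  rw [Real.log_div hx0.ne' hy0.ne'] at h
  have h2 : x / y - 1 ≤ β * (x - y) := by
    rw [div_sub_one hy0.ne', div_le_iff₀ hy0]
    nlinarith
  simp only
  linarith

lemma hasDerivAt_siteEnergy {t : ℝ} (ht : t ≠ 0) :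
    HasDerivAt (siteEnergy β) (Real.log t + 1 - β * t) t := by
  have h := (Real.hasDerivAt_mul_log ht).sub ((hasDerivAt_pow 2 t).const_mul (β / 2))
  refine h.congr_deriv ?_
  norm_num
  ring

lemma strictConcaveOn_siteEnergy (hβ : 0 < β) :
    StrictConcaveOn ℝ (Set.Ici (1 / β)) (siteEnergy β) := by
  refine StrictAntiOn.strictConcaveOn_of_deriv (convex_Ici _)
    continuous_siteEnergy.continuousOn ?_
  intro x hx y hy hxy
  have hβ' : 0 < 1 / β := by positivity
  rw [interior_Ici] at hx hy
  rw [(hasDerivAt_siteEnergy (hβ'.trans hx).ne').deriv,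
    (hasDerivAt_siteEnergy (hβ'.trans hy).ne').deriv]
  have h := log_sub_mul_strictAntiOn hβ (Set.mem_Ici.2 hx.le) (Set.mem_Ici.2 hy.le) hxy
  simp only at h
  linarith

lemma exists_siteEnergy_add_lt (hβ : 0 < β) {c : ℝ} (hc : 0 < c) :
    ∃ t, 0 ≤ t ∧ t ≤ c ∧ siteEnergy β t + siteEnergy β (c - t) < siteEnergy β c := by
  set e := Real.exp (-(β * c) - 1) with he
  have he0 : 0 < e := Real.exp_pos _
  have hβc : 0 < β * c := mul_pos hβ hc
  have he1 : e < 1 := by rw [he, Real.exp_lt_one_iff]; linarith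
  have hlt : c * e < c := by nlinarith
  refine ⟨c * e, by positivity, hlt.le, ?_⟩
  have h1 : Real.log (c * e) = Real.log c - β * c - 1 := by
    rw [Real.log_mul hc.ne' he0.ne', he, Real.log_exp]; ring
  have h2 : Real.log (c - c * e) ≤ Real.log c :=
    Real.log_le_log (by linarith) (by nlinarith)
  have h3 : (c - c * e) * Real.log (c - c * e) ≤ (c - c * e) * Real.log c :=
    mul_le_mul_of_nonneg_left h2 (by linarith)
  unfold siteEnergy
  rw [h1]
  have h4 : 0 < c * e := by positivity
  have h5 : 0 < β * (c * e) ^ 2 := by positivity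
  nlinarith

end SiteEnergy

section PeakSlope

variable {n β : ℝ}

lemma strictConvexOn_peakSlope :
    StrictConvexOn ℝ (Set.Ico (1 / 2) 1) (peakSlope n β) := by
  have hder : ∀ t ∈ Set.Ioo (0 : ℝ) 1, HasDerivAt (peakSlope n β)
      (1 / t + 1 / (1 - t) - β * (n + 1) / n) t := by
    intro t ht
    have h1 := Real.hasDerivAt_log ht.1.ne'
    have h2 := ((hasDerivAt_id t).const_sub 1).log (sub_pos.2 ht.2).ne'
    have h3 := ((((hasDerivAt_id t).const_mul (n + 1)).sub_const 1).const_mul β).div_const n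
    refine (((h1.sub h2).add_const (Real.log n)).sub h3).congr_deriv ?_
    simp only [id]
    ring
  have hsub : Set.Ico (1 / 2 : ℝ) 1 ⊆ Set.Ioo 0 1 := fun t ht =>
    ⟨lt_of_lt_of_le (by norm_num) ht.1, ht.2⟩
  refine StrictMonoOn.strictConvexOn_of_deriv (convex_Ico _ _)
    (fun t ht => (hder t (hsub ht)).continuousAt.continuousWithinAt) ?_
  rw [interior_Ico]
  intro x hx y hy hxy
  have hx' := hsub (Set.Ioo_subset_Ico_self hx)
  have hy' := hsub (Set.Ioo_subset_Ico_self hy)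
  rw [(hder x hx').deriv, (hder y hy').deriv]
  have key : ∀ t ∈ Set.Ioo (0 : ℝ) 1, 1 / t + 1 / (1 - t) = 1 / (t * (1 - t)) := by
    intro t ht
    have := ht.1.ne'
    have := (sub_pos.2 ht.2).ne'
    field_simp
    ring
  rw [key x hx', key y hy']
  have : 1 / (x * (1 - x)) < 1 / (y * (1 - y)) := by
    apply one_div_lt_one_div_of_lt (mul_pos hy'.1 (sub_pos.2 hy'.2))
    nlinarith [hx.1, hy.1]
  linarith

lemma peakSlope_half (hn : 1 ≤ n) :
    peakSlope n β (1 / 2) = (2 * Real.log n - β * (n - 1) / n) / 2 := by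
  have : n ≠ 0 := by positivity
  unfold peakSlope
  norm_num
  field_simp
  ring

lemma peakSlope_div_add_one (hn : 1 ≤ n) :
    peakSlope n β (n / (n + 1)) = 2 * Real.log n - β * (n - 1) / n := by
  have hn0 : n ≠ 0 := by positivity
  have hn1 : n + 1 ≠ 0 := by positivity
  have h1 : 1 - n / (n + 1) = 1 / (n + 1) := by field_simp; ring
  unfold peakSlope
  rw [h1, Real.log_div hn0 hn1, Real.log_div one_ne_zero hn1, Real.log_one,
    mul_div_cancel₀ _ hn1]
  ring

lemma half_le_div_add_one (hn : 1 ≤ n) : 1 / 2 ≤ n / (n + 1) := by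
  rw [div_le_div_iff₀ (by norm_num) (by linarith)]
  linarith

lemma div_add_one_lt_one (hn : 1 ≤ n) : n / (n + 1) < 1 := by
  rw [div_lt_one (by linarith)]
  linarith

lemma not_lt_of_peakSlope_eq_zero (hn : 1 ≤ n)
    (hs : 2 * Real.log n - β * (n - 1) / n ≤ 0) {b c : ℝ} (hb : n / (n + 1) < b)
    (hc : c < 1) (hDb : peakSlope n β b = 0) (hDc : peakSlope n β c = 0) : ¬ b < c := by
  intro hbc
  have hh := half_le_div_add_one hn
  have h := strictConvexOn_peakSlope (n := n) (β := β) |>.lt_on_openSegment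
    ⟨hh, div_add_one_lt_one hn⟩ ⟨hh.trans (hb.trans hbc).le, hc⟩ (hb.trans hbc).ne
    (show b ∈ openSegment ℝ (n / (n + 1)) c by
      rw [openSegment_eq_Ioo (hb.trans hbc)]; exact ⟨hb, hbc⟩)
  rw [hDb, hDc, peakSlope_div_add_one hn] at h
  exact absurd h (not_lt.2 (max_le hs le_rfl))

lemma div_add_one_lt_of_peakSlope_eq_zero (hn : 1 ≤ n)
    (hs : 2 * Real.log n - β * (n - 1) / n < 0) {b : ℝ} (hb : 1 / 2 ≤ b)
    (hDb : peakSlope n β b = 0) : n / (n + 1) < b := by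
  by_contra! hle
  have hh := half_le_div_add_one hn
  have h := strictConvexOn_peakSlope (n := n) (β := β) |>.convexOn.le_max_of_mem_Icc
    ⟨le_rfl, by norm_num⟩ ⟨hh, div_add_one_lt_one hn⟩ ⟨hb, hle⟩
  rw [hDb, peakSlope_half hn, peakSlope_div_add_one hn] at h
  exact absurd h (not_le.2 (max_lt (by linarith) hs))

end PeakSlope

section Critical

variable {q : ℕ} {β : ℝ}

lemma one_le_cast_sub_one (hq : 2 ≤ q) : (1 : ℝ) ≤ (q : ℝ) - 1 := by
  have : (2 : ℝ) ≤ q := by exact_mod_cast hq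
  linarith

lemma pos_of_betaC_lt (hq : 2 ≤ q) (hβ : betaC q < β) : 0 < β := by
  refine lt_of_le_of_lt ?_ hβ
  unfold betaC
  have h := one_le_cast_sub_one hq
  split_ifs with h2
  · positivity
  · exact mul_nonneg (div_nonneg (by linarith) (by linarith)) (Real.log_nonneg h)

lemma two_mul_log_sub_neg (hq : 3 ≤ q) (hβ : betaC q < β) :
    2 * Real.log ((q : ℝ) - 1) - β * ((q : ℝ) - 1 - 1) / ((q : ℝ) - 1) < 0 := by
  have hq' : (3 : ℝ) ≤ q := by exact_mod_cast hq
  rw [betaC, if_neg (by omega), div_mul_eq_mul_div, div_lt_iff₀ (by linarith)] at hβ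
  rw [sub_neg, lt_div_iff₀ (by linarith)]
  linarith

lemma two_mul_log_sub_nonpos (hq : 2 ≤ q) (hβ : betaC q < β) :
    2 * Real.log ((q : ℝ) - 1) - β * ((q : ℝ) - 1 - 1) / ((q : ℝ) - 1) ≤ 0 := by
  obtain rfl | h := hq.eq_or_lt
  · norm_num
  · exact (two_mul_log_sub_neg h hβ).le

end Critical

section PeakVec

variable {q : ℕ}

lemma sum_comp_peakVec (g : ℝ → ℝ) (b : ℝ) (i : Fin q) :
    ∑ k, g (peakVec q b i k) = g b + ((q : ℝ) - 1) * g ((1 - b) / ((q : ℝ) - 1)) := by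
  have hq : 1 ≤ q := Fin.pos i
  rw [← Finset.add_sum_erase _ _ (Finset.mem_univ i),
    Finset.sum_congr rfl (g := fun _ => g ((1 - b) / ((q : ℝ) - 1)))
      (fun k hk => by simp [peakVec, Finset.ne_of_mem_erase hk])]
  simp [peakVec, Nat.cast_sub hq]

lemma peakVec_mem_simplex (hq : 2 ≤ q) {b : ℝ} (hb0 : 0 ≤ b) (hb1 : b ≤ 1) (i : Fin q) :
    peakVec q b i ∈ simplex q := by
  have hn := one_le_cast_sub_one hq
  refine ⟨fun k => ?_, ?_⟩
  · unfold peakVec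
    split_ifs
    · exact hb0
    · exact div_nonneg (by linarith) (by linarith)
  · rw [sum_comp_peakVec (fun t => t), mul_div_cancel₀ _ (by linarith)]
    ring

lemma peakVec_injective (hq : 2 ≤ q) {b : ℝ} (hb : ((q : ℝ) - 1) / ((q : ℝ) - 1 + 1) < b) :
    Function.Injective (peakVec q b) := by
  have hn := one_le_cast_sub_one hq
  have hne : b ≠ (1 - b) / ((q : ℝ) - 1) := by
    rw [div_lt_iff₀ (by linarith)] at hb
    intro h
    rw [eq_div_iff (by linarith)] at h
    nlinarith
  intro i j hij
  by_contra h
  have := congrFun hij i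
  simp only [peakVec, h, if_true, if_false] at this
  exact hne this

end PeakVec

section FreeEnergy

variable {q : ℕ} [NeZero q] {β : ℝ}

lemma freeEnergy_eq_sum (x : Fin q → ℝ) :
    freeEnergy q β 0 x = ∑ i, siteEnergy β (x i) := by
  simp only [freeEnergy, siteEnergy, Finset.sum_sub_distrib, Finset.mul_sum, zero_mul, sub_zero]

lemma xvec_comp_perm (z : ℝ) (σ : Equiv.Perm (Fin q)) :
    xvec q z ∘ σ = peakVec q ((1 + z) / 2) (σ.symm 0) := by
  funext k
  by_cases h : σ k = 0
  · simp [xvec, peakVec, h, Equiv.eq_symm_apply]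
  · simp only [Function.comp, xvec, peakVec, Equiv.eq_symm_apply, h, if_false]
    rw [show 1 - (1 + z) / 2 = (1 - z) / 2 by ring, div_div]

lemma setOf_xvec_comp_perm (z : ℝ) :
    {y | ∃ σ : Equiv.Perm (Fin q), y = xvec q z ∘ σ}
      = Set.range (peakVec q ((1 + z) / 2)) := by
  ext y
  simp only [Set.mem_ofPred_eq, Set.mem_range, xvec_comp_perm]
  constructor
  · rintro ⟨σ, rfl⟩
    exact ⟨_, rfl⟩
  · rintro ⟨i, rfl⟩
    exact ⟨Equiv.swap 0 i, by simp⟩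

lemma minimizers_nonempty : (minimizers q β).Nonempty := by
  have hcpt : IsCompact (simplex q) := by
    have : simplex q = stdSimplex ℝ (Fin q) := rfl
    exact this ▸ isCompact_stdSimplex ℝ (Fin q)
  have hne : (simplex q).Nonempty :=
    ⟨Pi.single 0 1, single_mem_stdSimplex ℝ (0 : Fin q)⟩
  have hcont : Continuous (freeEnergy q β 0) := by
    rw [funext freeEnergy_eq_sum]
    exact continuous_finsetSum _ fun i _ => continuous_siteEnergy.comp (continuous_apply i)
  obtain ⟨x, hx, hmin⟩ := hcpt.exists_isMinOn hne hcont.continuousOn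
  exact ⟨x, hx, fun w hw => hmin hw⟩

variable {x : Fin q → ℝ}

lemma siteEnergy_add_le_of_mem_minimizers (hx : x ∈ minimizers q β) {i j : Fin q}
    (hij : i ≠ j) {u v : ℝ} (hu : 0 ≤ u) (hv : 0 ≤ v) (huv : u + v = x i + x j) :
    siteEnergy β (x i) + siteEnergy β (x j) ≤ siteEnergy β u + siteEnergy β v := by
  set w : Fin q → ℝ := Function.update (Function.update x i u) j v with hw
  have hwi : w i = u := by simp [hw, hij]
  have hwj : w j = v := by simp [hw]
  have hwk : ∀ k, k ≠ i → k ≠ j → w k = x k := fun k hki hkj => by simp [hw, hki, hkj]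
  have hsum : ∀ (g : ℝ → ℝ) (y : Fin q → ℝ),
      ∑ k, g (y k) = g (y i) + g (y j) + ∑ k ∈ (Finset.univ.erase i).erase j, g (y k) := by
    intro g y
    rw [← Finset.add_sum_erase _ _ (Finset.mem_univ i),
      ← Finset.add_sum_erase _ _ (Finset.mem_erase.2 ⟨hij.symm, Finset.mem_univ j⟩), add_assoc]
  have hrest : ∀ g : ℝ → ℝ, ∑ k ∈ (Finset.univ.erase i).erase j, g (w k)
      = ∑ k ∈ (Finset.univ.erase i).erase j, g (x k) := fun g =>
    Finset.sum_congr rfl fun k hk => by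
      simp only [Finset.mem_erase] at hk
      rw [hwk k hk.2.1 hk.1]
  have hws : w ∈ simplex q := by
    refine ⟨fun k => ?_, ?_⟩
    · by_cases hki : k = i
      · rw [hki, hwi]; exact hu
      by_cases hkj : k = j
      · rw [hkj, hwj]; exact hv
      rw [hwk k hki hkj]
      exact hx.1.1 k
    · have h1 := hsum (fun t => t) w
      have h2 := hsum (fun t => t) x
      have h3 := hrest fun t => t
      have h4 := hx.1.2
      simp only [hwi, hwj] at h1 h2 h3
      linarith
  have h := hx.2 w hws
  rw [freeEnergy_eq_sum, freeEnergy_eq_sum, hsum, hsum _ w, hrest, hwi, hwj] at h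
  linarith

lemma pos_of_mem_minimizers (hβ : 0 < β) (hx : x ∈ minimizers q β) (j : Fin q) : 0 < x j := by
  refine lt_of_le_of_ne (hx.1.1 j) fun hj => ?_
  obtain ⟨i, -, hi⟩ : ∃ i ∈ Finset.univ, 0 < x i := by
    by_contra! h
    have := Finset.sum_nonpos h
    rw [hx.1.2] at this
    linarith
  have hij : i ≠ j := by
    rintro rfl
    exact hi.ne hj
  obtain ⟨t, ht0, htc, hlt⟩ := exists_siteEnergy_add_lt hβ hi
  have h := siteEnergy_add_le_of_mem_minimizers hx hij ht0 (sub_nonneg.2 htc)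
    (by rw [← hj]; ring)
  rw [← hj] at h
  have h0 : siteEnergy β 0 = 0 := by simp [siteEnergy]
  linarith

lemma log_sub_mul_eq_of_mem_minimizers (hβ : 0 < β) (hx : x ∈ minimizers q β) (i j : Fin q) :
    Real.log (x i) - β * x i = Real.log (x j) - β * x j := by
  obtain rfl | hij := eq_or_ne i j
  · rfl
  have hi := pos_of_mem_minimizers hβ hx i
  have hj := pos_of_mem_minimizers hβ hx j
  have hmin : IsLocalMin (fun t => siteEnergy β (x i + t) + siteEnergy β (x j - t)) 0 := by
    filter_upwards [Ioo_mem_nhds (neg_lt_zero.2 hi) hj] with t ht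
    simp only [add_zero, sub_zero]
    exact siteEnergy_add_le_of_mem_minimizers hx hij (by linarith [ht.1]) (by linarith [ht.2])
      (by ring)
  have h1 : HasDerivAt (fun t => siteEnergy β (x i + t))
      (Real.log (x i) + 1 - β * x i) 0 := by
    apply HasDerivAt.comp_const_add
    simpa using hasDerivAt_siteEnergy hi.ne'
  have h2 : HasDerivAt (fun t => siteEnergy β (x j - t))
      (-(Real.log (x j) + 1 - β * x j)) 0 := by
    apply HasDerivAt.comp_const_sub
    simpa using hasDerivAt_siteEnergy hj.ne'
  have h := hmin.hasDerivAt_eq_zero (h1.add h2)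
  linarith

lemma le_one_div_of_mem_minimizers (hβ : 0 < β) (hx : x ∈ minimizers q β) {i j : Fin q}
    (hij : i ≠ j) (h : x i = x j) : x i ≤ 1 / β := by
  by_contra! hlt
  have hβ' : 0 < 1 / β := by positivity
  have hle := siteEnergy_add_le_of_mem_minimizers hx hij (u := 1 / β) (v := 2 * x i - 1 / β)
    hβ'.le (by linarith) (by linarith)
  have hhalf : (0 : ℝ) < 1 / 2 := by norm_num
  have hc := (strictConcaveOn_siteEnergy hβ).2 (Set.mem_Ici.2 le_rfl)
    (Set.mem_Ici.2 (show 1 / β ≤ 2 * x i - 1 / β by linarith)) (by linarith) hhalf hhalf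
    (by norm_num)
  have he : (1 / 2 : ℝ) * (1 / β) + 1 / 2 * (2 * x i - 1 / β) = x i := by ring
  simp only [smul_eq_mul, he] at hc
  rw [← h] at hle
  linarith

lemma eq_of_ne_of_mem_minimizers (hβ : 0 < β) (hx : x ∈ minimizers q β) {i : Fin q}
    (hmax : ∀ k, x k ≤ x i) {j k : Fin q} (hj : j ≠ i) (hk : k ≠ i) : x j = x k := by
  have hle : ∀ l, l ≠ i → x l ∈ Set.Ioc 0 (1 / β) := by
    intro l hl
    refine ⟨pos_of_mem_minimizers hβ hx l, ?_⟩
    by_contra! hlt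
    have h := (log_sub_mul_strictAntiOn hβ).injOn (Set.mem_Ici.2 hlt.le)
      (Set.mem_Ici.2 (hlt.le.trans (hmax l))) (log_sub_mul_eq_of_mem_minimizers hβ hx l i)
    exact absurd (le_one_div_of_mem_minimizers hβ hx hl h) (not_le.2 hlt)
  exact (log_sub_mul_strictMonoOn hβ).injOn (hle j hj) (hle k hk)
    (log_sub_mul_eq_of_mem_minimizers hβ hx j k)

lemma exists_eq_peakVec_of_mem_minimizers (hq : 2 ≤ q) (hβ : 0 < β)
    (hx : x ∈ minimizers q β) :
    ∃ b i, x = peakVec q b i ∧ (1 - b) / ((q : ℝ) - 1) ≤ b := by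
  have hn := one_le_cast_sub_one hq
  obtain ⟨i, -, hmax⟩ := Finset.exists_max_image Finset.univ x ⟨0, Finset.mem_univ 0⟩
  have hmax' : ∀ k, x k ≤ x i := fun k => hmax k (Finset.mem_univ k)
  have hval : ∀ k, k ≠ i → x k = (1 - x i) / ((q : ℝ) - 1) := by
    intro k hk
    have h := hx.1.2
    rw [← Finset.add_sum_erase _ _ (Finset.mem_univ i),
      Finset.sum_congr rfl (g := fun _ => x k) (fun l hl =>
        eq_of_ne_of_mem_minimizers hβ hx hmax' (Finset.ne_of_mem_erase hl) hk)] at h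
    simp only [Finset.sum_const, Finset.card_erase_of_mem (Finset.mem_univ i),
      Finset.card_univ, Fintype.card_fin, nsmul_eq_mul] at h
    rw [Nat.cast_sub (by omega), Nat.cast_one] at h
    rw [eq_div_iff (by linarith)]
    linarith
  refine ⟨x i, i, ?_, ?_⟩
  · funext k
    by_cases hk : k = i
    · simp [peakVec, hk]
    · simp [peakVec, hk, hval k hk]
  · have : Nontrivial (Fin q) := Fin.nontrivial_iff_two_le.2 hq
    obtain ⟨k, hk⟩ := exists_ne i
    rw [← hval k hk]
    exact hmax' k

lemma peakSlope_eq_zero_of_peakVec_mem_minimizers (hq : 2 ≤ q) (hβ : 0 < β) {b : ℝ}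
    {i : Fin q} (hx : peakVec q b i ∈ minimizers q β) :
    0 < b ∧ b < 1 ∧ peakSlope ((q : ℝ) - 1) β b = 0 := by
  have hn := one_le_cast_sub_one hq
  have : Nontrivial (Fin q) := Fin.nontrivial_iff_two_le.2 hq
  obtain ⟨k, hk⟩ := exists_ne i
  have hi := pos_of_mem_minimizers hβ hx i
  have hk0 := pos_of_mem_minimizers hβ hx k
  have h := log_sub_mul_eq_of_mem_minimizers hβ hx i k
  simp only [peakVec, hk, if_true, if_false] at hi hk0 h
  have hb1 : 0 < 1 - b := (div_pos_iff_of_pos_right (by linarith)).1 hk0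
  refine ⟨hi, by linarith, ?_⟩
  rw [Real.log_div hb1.ne' (by linarith)] at h
  have hn0 : (q : ℝ) - 1 ≠ 0 := by linarith
  have he : β * (((q : ℝ) - 1 + 1) * b - 1) / ((q : ℝ) - 1)
      = β * b - β * ((1 - b) / ((q : ℝ) - 1)) := by
    field_simp
    ring
  rw [peakSlope, he]
  linarith

lemma half_le_of_peakVec_mem_minimizers (hq : 3 ≤ q) (hβ : betaC q < β) {b : ℝ}
    {i : Fin q} (hx : peakVec q b i ∈ minimizers q β) : 1 / 2 ≤ b := by
  have hq2 : 2 ≤ q := by omega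
  have hβ0 := pos_of_betaC_lt hq2 hβ
  have hs := two_mul_log_sub_neg hq hβ
  have hn := one_le_cast_sub_one hq2
  obtain ⟨hb0, hb1, -⟩ := peakSlope_eq_zero_of_peakVec_mem_minimizers hq2 hβ0 hx
  have h := hx.2 _ (peakVec_mem_simplex hq2 (b := 1 - b) (by linarith) (by linarith) i)
  rw [freeEnergy_eq_sum, freeEnergy_eq_sum, sum_comp_peakVec, sum_comp_peakVec,
    sub_sub_cancel] at h
  generalize (q : ℝ) - 1 = n at *
  have hn0 : n ≠ 0 := by linarith
  have key : (siteEnergy β (1 - b) + n * siteEnergy β (b / n))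
      - (siteEnergy β b + n * siteEnergy β ((1 - b) / n))
      = (1 / 2 - b) * (2 * Real.log n - β * (n - 1) / n) := by
    unfold siteEnergy
    rw [Real.log_div hb0.ne' hn0, Real.log_div (sub_pos.2 hb1).ne' hn0]
    field_simp
    ring
  nlinarith

lemma lt_of_peakVec_mem_minimizers (hq : 2 ≤ q) (hβ : betaC q < β) {b : ℝ} {i : Fin q}
    (hx : peakVec q b i ∈ minimizers q β) (hb : (1 - b) / ((q : ℝ) - 1) ≤ b) :
    ((q : ℝ) - 1) / ((q : ℝ) - 1 + 1) < b := by
  have hβ0 := pos_of_betaC_lt hq hβ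
  obtain h2 | h3 := hq.eq_or_lt
  · subst h2
    norm_num at hb ⊢
    refine lt_of_le_of_ne (by linarith) fun hb2 => ?_
    obtain ⟨k, hk⟩ := exists_ne i
    have h := le_one_div_of_mem_minimizers hβ0 hx hk.symm
      (by simp only [peakVec, hk, if_true, if_false, ← hb2]; norm_num)
    simp only [peakVec, if_true, ← hb2] at h
    norm_num [betaC] at hβ
    rw [le_div_iff₀ hβ0] at h
    linarith
  · exact div_add_one_lt_of_peakSlope_eq_zero (one_le_cast_sub_one hq)
      (two_mul_log_sub_neg h3 hβ) (half_le_of_peakVec_mem_minimizers h3 hβ hx)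
      (peakSlope_eq_zero_of_peakVec_mem_minimizers hq hβ0 hx).2.2

lemma peakVec_mem_minimizers_congr {b : ℝ} {i : Fin q} (hx : peakVec q b i ∈ minimizers q β)
    (hq : 2 ≤ q) (hβ : 0 < β) (j : Fin q) : peakVec q b j ∈ minimizers q β := by
  obtain ⟨hb0, hb1, -⟩ := peakSlope_eq_zero_of_peakVec_mem_minimizers hq hβ hx
  refine ⟨peakVec_mem_simplex hq hb0.le hb1.le j, fun w hw => ?_⟩
  have h := hx.2 w hw
  rw [freeEnergy_eq_sum, sum_comp_peakVec] at h
  rwa [freeEnergy_eq_sum, sum_comp_peakVec]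

lemma exists_minimizers_eq_range_peakVec (hq : 2 ≤ q) (hβ : betaC q < β) :
    ∃ b, ((q : ℝ) - 1) / ((q : ℝ) - 1 + 1) < b ∧ b < 1 ∧
      minimizers q β = Set.range (peakVec q b) := by
  have hβ0 := pos_of_betaC_lt hq hβ
  obtain ⟨x, hx⟩ := minimizers_nonempty (q := q) (β := β)
  obtain ⟨b, i, rfl, hb⟩ := exists_eq_peakVec_of_mem_minimizers hq hβ0 hx
  have hlt := lt_of_peakVec_mem_minimizers hq hβ hx hb
  obtain ⟨-, hb1, hDb⟩ := peakSlope_eq_zero_of_peakVec_mem_minimizers hq hβ0 hx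
  refine ⟨b, hlt, hb1, Set.Subset.antisymm ?_ ?_⟩
  · intro y hy
    obtain ⟨c, j, rfl, hc⟩ := exists_eq_peakVec_of_mem_minimizers hq hβ0 hy
    have hlt' := lt_of_peakVec_mem_minimizers hq hβ hy hc
    obtain ⟨-, hc1, hDc⟩ := peakSlope_eq_zero_of_peakVec_mem_minimizers hq hβ0 hy
    have hn := one_le_cast_sub_one hq
    have hs := two_mul_log_sub_nonpos hq hβ
    have hbc : b = c := le_antisymm
      (not_lt.1 (not_lt_of_peakSlope_eq_zero hn hs hlt' hb1 hDc hDb))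
      (not_lt.1 (not_lt_of_peakSlope_eq_zero hn hs hlt hc1 hDb hDc))
    exact ⟨j, by rw [hbc]⟩
  · rintro _ ⟨j, rfl⟩
    exact peakVec_mem_minimizers_congr hx hq hβ0 j

end FreeEnergy

/-- for `h = 0` and `β > β_c`, `f_{β,0}` has exactly `q` global
minimizers, namely the coordinate permutations of `x_z` for some `z ∈ ((q−2)/q, 1)`. -/
theorem stmt_8 (q : ℕ) [NeZero q] (hq : 2 ≤ q) (β : ℝ) (hβ : betaC q < β) :
    ∃ z : ℝ, ((q : ℝ) - 2) / q < z ∧ z < 1 ∧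
      ({y | y ∈ simplex q ∧ ∀ w ∈ simplex q, freeEnergy q β 0 y ≤ freeEnergy q β 0 w}
          = {y | ∃ σ : Equiv.Perm (Fin q), y = xvec q z ∘ σ}) ∧
      Set.ncard {y | y ∈ simplex q ∧
          ∀ w ∈ simplex q, freeEnergy q β 0 y ≤ freeEnergy q β 0 w} = q := by
  obtain ⟨b, hb, hb1, hmin⟩ := exists_minimizers_eq_range_peakVec hq hβ
  have hz : (1 + (2 * b - 1)) / 2 = b := by ring
  have hq0 : (0 : ℝ) < q := by positivity
  refine ⟨2 * b - 1, ?_, by linarith, ?_, ?_⟩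
  · rw [sub_add_cancel, div_lt_iff₀ hq0] at hb
    rw [div_lt_iff₀ hq0]
    linarith
  · rw [setOf_xvec_comp_perm, hz]
    exact hmin
  · change (minimizers q β).ncard = q
    rw [hmin, Set.ncard_range_of_injective (peakVec_injective hq hb)]
    simp
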